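/- Suppose Σ is linear, S_xu and D are convex and compact, the origin is a forced equilibrium of 𝒟(Σ) in the interior of S_xu × D with 0 ∈ π_n(C_{max,p_0}), and 𝒟(Σ) is controllable. For any N ≥ n, let γ_max be the maximal γ such that γ C_{max,co} ⊆ Pre^N_{𝒟(Σ)}({0}, S_xu × D), and let λ_0 be the maximal λ with λ C_{max,co} ⊆ π_n(C_{max,p_0}). Then (i) γ_max > 0, and (ii) for all k ≥ 0, (1 − (1 − λ_0)(1 − γ_max)^k) C_{max,co} ⊆ π_n(C_{max,p_0+kN}) ⊆ C_{max,co}. -/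

import Mathlib

open Set Pointwise

section Defs

variable {X U W : Type*}

/-- Robust controlled invariant set of `x⁺ = f x u d` (disturbance `d ∈ D`) in safe set `S`. -/
def IsRCIS (f : X → U → W → X) (D : Set W) (S : Set (X × U)) (C : Set X) : Prop :=
  ∀ x ∈ C, ∃ u, (x, u) ∈ S ∧ ∀ d ∈ D, f x u d ∈ C

/-- Maximal RCIS: an RCIS containing every RCIS. -/
def IsMaxRCIS (f : X → U → W → X) (D : Set W) (S : Set (X × U)) (C : Set X) : Prop :=
  IsRCIS f D S C ∧ ∀ C', IsRCIS f D S C' → C' ⊆ C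

/-- Controlled invariant set of the disturbance-free system `x⁺ = g x u` in safe set `S`. -/
def IsCIS (g : X → U → X) (S : Set (X × U)) (C : Set X) : Prop :=
  ∀ x ∈ C, ∃ u, (x, u) ∈ S ∧ g x u ∈ C

/-- Maximal CIS. -/
def IsMaxCIS (g : X → U → X) (S : Set (X × U)) (C : Set X) : Prop :=
  IsCIS g S C ∧ ∀ C', IsCIS g S C' → C' ⊆ C

/-- One-step backward reachable set for a disturbance-free system. -/
def pre (g : X → U → X) (S : Set (X × U)) (T : Set X) : Set X :=
  {x | ∃ u, (x, u) ∈ S ∧ g x u ∈ T}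

/-- `k`-step backward reachable set for a disturbance-free system. -/
def preN (g : X → U → X) (S : Set (X × U)) : ℕ → Set X → Set X
  | 0, T => T
  | k + 1, T => pre g S (preN g S k T)

/-- One-step robust backward reachable set for a system with disturbance `d ∈ D`. -/
def preR (f : X → U → W → X) (D : Set W) (S : Set (X × U)) (T : Set X) : Set X :=
  {x | ∃ u, (x, u) ∈ S ∧ ∀ d ∈ D, f x u d ∈ T}

/-- `k`-step robust backward reachable set. -/
def preRN (f : X → U → W → X) (D : Set W) (S : Set (X × U)) : ℕ → Set X → Set X
  | 0, T => T
  | k + 1, T => preR f D S (preRN f D S k T)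

/-- Dynamics of the `p`-augmented system `Σ_p`: state `(x, d_{1:p})`,
`x⁺ = f x u d₁`, `dᵢ⁺ = d_{i+1}`, `d_p⁺ = d` (new disturbance). -/
def augDyn (f : X → U → W → X) (p : ℕ) :
    X × (Fin p → W) → U → W → X × (Fin p → W) :=
  fun s u dnew =>
    (f s.1 u (if h : 0 < p then s.2 ⟨0, h⟩ else dnew),
     fun i => if h : (i : ℕ) + 1 < p then s.2 ⟨(i : ℕ) + 1, h⟩ else dnew)

/-- Safe set `S_{xu,p}` of the `p`-augmented system. -/
def augSafe (S : Set (X × U)) (D : Set W) (p : ℕ) :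
    Set ((X × (Fin p → W)) × U) :=
  {s | (s.1.1, s.2) ∈ S ∧ ∀ i, s.1.2 i ∈ D}

/-- Dynamics of the disturbance collaborative system `𝒟(Σ)`:
the disturbance becomes a second control input. -/
def dcDyn (f : X → U → W → X) : X → U × W → X := fun x v => f x v.1 v.2

/-- Safe set `S_xu × D` of the disturbance collaborative system. -/
def dcSafe (S : Set (X × U)) (D : Set W) : Set (X × (U × W)) :=
  {s | (s.1, s.2.1) ∈ S ∧ s.2.2 ∈ D}

/-- The set `C × D^{p-p'}` viewed inside the state space of `Σ_p`, for `p' ≤ p`. -/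
def liftSet {p' p : ℕ} (h : p' ≤ p) (C : Set (X × (Fin p' → W))) (D : Set W) :
    Set (X × (Fin p → W)) :=
  {s | (s.1, fun i : Fin p' => s.2 (Fin.castLE h i)) ∈ C ∧
    ∀ i : Fin p, p' ≤ (i : ℕ) → s.2 i ∈ D}

/-- The set `C × D^p` viewed inside the state space of `Σ_p`, for `C ⊆ X`. -/
def prodD (C : Set X) (D : Set W) (p : ℕ) : Set (X × (Fin p → W)) :=
  {s | s.1 ∈ C ∧ ∀ i : Fin p, s.2 i ∈ D}

/-- The feasible domain `ℱ_p(C)` of the preview MPC with prediction horizon `p`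
and terminal constraint set `C`. -/
def feasDom (f : X → U → W → X) (D : Set W) (S : Set (X × U)) (C : Set X) (p : ℕ) :
    Set (X × (Fin p → W)) :=
  {s | (∀ i, s.2 i ∈ D) ∧
    ∃ xs : Fin (p + 1) → X, ∃ us : Fin p → U,
      xs 0 = s.1 ∧
      (∀ t : Fin p, xs t.succ = f (xs t.castSucc) (us t) (s.2 t) ∧
        (xs t.castSucc, us t) ∈ S) ∧
      xs (Fin.last p) ∈ C}

end Defs

/-- Linear dynamics `x⁺ = A x + B u + E d` on plain vector spaces `Fin n → ℝ`. -/
def linDyn {n m l : ℕ} (A : Matrix (Fin n) (Fin n) ℝ) (B : Matrix (Fin n) (Fin m) ℝ)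
    (E : Matrix (Fin n) (Fin l) ℝ) :
    (Fin n → ℝ) → (Fin m → ℝ) → (Fin l → ℝ) → (Fin n → ℝ) :=
  fun x u d => A.mulVec x + B.mulVec u + E.mulVec d

/-- Linear dynamics `x⁺ = A x + B u + E d` on Euclidean spaces. -/
noncomputable def linDynE {n m l : ℕ} (A : Matrix (Fin n) (Fin n) ℝ)
    (B : Matrix (Fin n) (Fin m) ℝ) (E : Matrix (Fin n) (Fin l) ℝ) :
    EuclideanSpace ℝ (Fin n) → EuclideanSpace ℝ (Fin m) → EuclideanSpace ℝ (Fin l) →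
      EuclideanSpace ℝ (Fin n) :=
  fun x u d => (EuclideanSpace.equiv (Fin n) ℝ).symm
    (A.mulVec (EuclideanSpace.equiv (Fin n) ℝ x) + B.mulVec (EuclideanSpace.equiv (Fin m) ℝ u)
      + E.mulVec (EuclideanSpace.equiv (Fin l) ℝ d))

section Invariance

variable {X U W : Type*} {g : X → U → X} {S : Set (X × U)}

theorem IsCIS.subset_pre {C : Set X} (hC : IsCIS g S C) : C ⊆ pre g S C := hC

theorem pre_mono {T T' : Set X} (h : T ⊆ T') : pre g S T ⊆ pre g S T' :=
  fun _ ⟨u, hu, hx⟩ => ⟨u, hu, h hx⟩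

theorem IsMaxCIS.pre_subset {C T : Set X} (hC : IsMaxCIS g S C) (hT : T ⊆ C) :
    pre g S T ⊆ C :=
  (pre_mono hT).trans (hC.2 _ fun _ ⟨u, hu, hx⟩ => ⟨u, hu, hC.1.subset_pre hx⟩)

theorem IsMaxCIS.preN_subset {C T : Set X} (hC : IsMaxCIS g S C) (hT : T ⊆ C) (k : ℕ) :
    preN g S k T ⊆ C := by
  induction k with
  | zero => exact hT
  | succ k ih => exact hC.pre_subset ih

theorem IsCIS.subset_preN {C : Set X} (hC : IsCIS g S C) (k : ℕ) : C ⊆ preN g S k C := by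
  induction k with
  | zero => exact subset_rfl
  | succ k ih => exact hC.subset_pre.trans (pre_mono ih)

/-- The projection of an RCIS of the augmented system is a CIS of the collaborative system. -/
theorem IsRCIS.isCIS_image_fst {f : X → U → W → X} {D : Set W} {p : ℕ}
    {C : Set (X × (Fin p → W))} (hD : D.Nonempty)
    (hC : IsRCIS (augDyn f p) D (augSafe S D p) C) :
    IsCIS (dcDyn f) (dcSafe S D) (Prod.fst '' C) := by
  rintro _ ⟨s, hs, rfl⟩
  obtain ⟨d₀, hd₀⟩ := hD
  obtain ⟨u, hu, hnext⟩ := hC s hs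
  refine ⟨(u, if h : 0 < p then s.2 ⟨0, h⟩ else d₀), ⟨hu.1, ?_⟩, _, hnext d₀ hd₀, rfl⟩
  dsimp only
  split_ifs with h
  exacts [hu.2 _, hd₀]

/-- One additional preview step enlarges the projection of the maximal RCIS by at least one
backward step of the collaborative system. -/
theorem pre_image_fst_subset {f : X → U → W → X} {D : Set W} {p : ℕ}
    {C : Set (X × (Fin p → W))} {C' : Set (X × (Fin (p + 1) → W))}
    (hC : IsRCIS (augDyn f p) D (augSafe S D p) C)
    (hC' : IsMaxRCIS (augDyn f (p + 1)) D (augSafe S D (p + 1)) C') :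
    pre (dcDyn f) (dcSafe S D) (Prod.fst '' C) ⊆ Prod.fst '' C' := by
  have key : IsRCIS (augDyn f (p + 1)) D (augSafe S D (p + 1))
      {s | s.2 0 ∈ D ∧ ∃ u, (s.1, u) ∈ S ∧ (f s.1 u (s.2 0), fun i => s.2 i.succ) ∈ C} := by
    rintro ⟨x, d⟩ ⟨hd, u, hu, hx⟩
    obtain ⟨u', hu', hnext⟩ := hC _ hx
    refine ⟨u, ⟨hu, Fin.cases hd hu'.2⟩, fun e he => ?_⟩
    have hn := hnext e he
    rcases p with _ | p
    · refine ⟨by simpa [augDyn] using he, u', ?_, ?_⟩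
      · simpa [augDyn] using hu'.1
      · convert hn using 1
        simp only [augDyn]
        exact Prod.ext (by simp) (Subsingleton.elim _ _)
    · refine ⟨by simpa [augDyn] using hu'.2 0, u', ?_, ?_⟩
      · simpa [augDyn] using hu'.1
      · convert hn using 1
        simp [augDyn, Fin.succ]
  rintro x ⟨⟨u, d⟩, ⟨hu, hd⟩, ⟨y, e⟩, hye, hy⟩
  refine ⟨(x, Fin.cons d e), hC'.2 _ key ⟨by simpa using hd, u, hu, ?_⟩, rfl⟩
  have hy' : f x u d = y := hy.symm
  simpa [hy'] using hye

theorem preN_image_fst_subset {f : X → U → W → X} {D : Set W}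
    {C : (q : ℕ) → Set (X × (Fin q → W))}
    (hC : ∀ q, IsMaxRCIS (augDyn f q) D (augSafe S D q) (C q)) (p k : ℕ) :
    preN (dcDyn f) (dcSafe S D) k (Prod.fst '' C p) ⊆ Prod.fst '' C (p + k) := by
  induction k with
  | zero => exact subset_rfl
  | succ k ih => exact (pre_mono ih).trans (pre_image_fst_subset (hC (p + k)).1 (hC (p + k + 1)))

end Invariance

section Linear

variable {n m l : ℕ} (A : Matrix (Fin n) (Fin n) ℝ) (B : Matrix (Fin n) (Fin m) ℝ)
  (E : Matrix (Fin n) (Fin l) ℝ)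

theorem dcDyn_linDyn_smul (a : ℝ) (x : Fin n → ℝ) (v : (Fin m → ℝ) × (Fin l → ℝ)) :
    dcDyn (linDyn A B E) (a • x) (a • v) = a • dcDyn (linDyn A B E) x v := by
  simp [dcDyn, linDyn, Matrix.mulVec_smul, smul_add]

theorem dcDyn_linDyn_add (x y : Fin n → ℝ) (v w : (Fin m → ℝ) × (Fin l → ℝ)) :
    dcDyn (linDyn A B E) (x + y) (v + w) =
      dcDyn (linDyn A B E) x v + dcDyn (linDyn A B E) y w := by
  simp only [dcDyn, linDyn, Prod.fst_add, Prod.snd_add, Matrix.mulVec_add]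
  abel

theorem dcDyn_linDyn_zero : dcDyn (linDyn A B E) 0 0 = 0 := by
  simp [dcDyn, linDyn]

theorem convex_dcSafe {X U W : Type*} [AddCommGroup X] [Module ℝ X] [AddCommGroup U]
    [Module ℝ U] [AddCommGroup W] [Module ℝ W] {S : Set (X × U)} {D : Set W}
    (hS : Convex ℝ S) (hD : Convex ℝ D) : Convex ℝ (dcSafe S D) :=
  fun _ hx _ hy _ _ ha hb hab => ⟨hS hx.1 hy.1 ha hb hab, hD hx.2 hy.2 ha hb hab⟩

variable {A B E}

/-- Convex combinations of safe trajectories are safe trajectories. -/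
theorem preN_combo {Q : Set ((Fin n → ℝ) × ((Fin m → ℝ) × (Fin l → ℝ)))} (hQ : Convex ℝ Q)
    {a b : ℝ} (ha : 0 ≤ a) (hb : 0 ≤ b) (hab : a + b = 1) {P R T : Set (Fin n → ℝ)}
    (h : ∀ x ∈ P, ∀ y ∈ R, a • x + b • y ∈ T) (k : ℕ) :
    ∀ x ∈ preN (dcDyn (linDyn A B E)) Q k P, ∀ y ∈ preN (dcDyn (linDyn A B E)) Q k R,
      a • x + b • y ∈ preN (dcDyn (linDyn A B E)) Q k T := by
  induction k with
  | zero => exact h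
  | succ k ih =>
    rintro x ⟨v, hv, hx⟩ y ⟨w, hw, hy⟩
    refine ⟨a • v + b • w, hQ hv hw ha hb hab, ?_⟩
    rw [dcDyn_linDyn_add, dcDyn_linDyn_smul, dcDyn_linDyn_smul]
    exact ih _ hx _ hy

theorem convex_preN_zero {Q : Set ((Fin n → ℝ) × ((Fin m → ℝ) × (Fin l → ℝ)))}
    (hQ : Convex ℝ Q) (k : ℕ) : Convex ℝ (preN (dcDyn (linDyn A B E)) Q k {0}) :=
  fun x hx y hy _ _ ha hb hab =>
    preN_combo hQ ha hb hab (by simp) k x hx y hy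

/-- A linear trajectory ending at the origin becomes safe after sufficient scaling. -/
theorem eventually_smul_mem_preN {Q : Set ((Fin n → ℝ) × ((Fin m → ℝ) × (Fin l → ℝ)))}
    (hQ : Q ∈ nhds 0) (k : ℕ) :
    ∀ x ∈ preN (dcDyn (linDyn A B E)) univ k {0},
      ∀ᶠ t : ℝ in nhds 0, t • x ∈ preN (dcDyn (linDyn A B E)) Q k {0} := by
  induction k with
  | zero =>
    rintro x hx
    have hx0 : x = 0 := hx
    simp [preN, hx0]
  | succ k ih =>
    rintro x ⟨v, -, hx⟩
    have hc : Filter.Tendsto (fun t : ℝ => t • (x, v)) (nhds 0) (nhds 0) := by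
      have : Continuous fun t : ℝ => t • (x, v) := by fun_prop
      simpa using this.tendsto 0
    filter_upwards [hc.eventually hQ, ih _ hx] with t ht h't
    exact ⟨t • v, ht, by rwa [dcDyn_linDyn_smul]⟩

theorem exists_sub_mem_span_of_mem_span_succ (k : ℕ) {y : Fin n → ℝ}
    (hy : y ∈ Submodule.span ℝ
      {v : Fin n → ℝ | ∃ j : ℕ, j < k + 1 ∧ ∃ (w : Fin m → ℝ) (z : Fin l → ℝ),
        v = (A ^ j).mulVec (B.mulVec w + E.mulVec z)}) :
    ∃ (w : Fin m → ℝ) (z : Fin l → ℝ),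
      y - (A ^ k).mulVec (B.mulVec w + E.mulVec z) ∈ Submodule.span ℝ
        {v : Fin n → ℝ | ∃ j : ℕ, j < k ∧ ∃ (w : Fin m → ℝ) (z : Fin l → ℝ),
          v = (A ^ j).mulVec (B.mulVec w + E.mulVec z)} := by
  induction hy using Submodule.span_induction with
  | mem y hy =>
    obtain ⟨j, hj, w, z, rfl⟩ := hy
    rcases Nat.lt_succ_iff_lt_or_eq.mp hj with hj | rfl
    · exact ⟨0, 0, Submodule.subset_span ⟨j, hj, w, z, by simp⟩⟩
    · exact ⟨w, z, by simp⟩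
  | zero => exact ⟨0, 0, by simp⟩
  | add x y _ _ hx hy =>
    obtain ⟨w, z, h⟩ := hx
    obtain ⟨w', z', h'⟩ := hy
    refine ⟨w + w', z + z', ?_⟩
    convert Submodule.add_mem _ h h' using 1
    simp only [Matrix.mulVec_add]
    abel
  | smul a x _ hx =>
    obtain ⟨w, z, h⟩ := hx
    refine ⟨a • w, a • z, ?_⟩
    convert Submodule.smul_mem _ a h using 1
    simp only [Matrix.mulVec_add, Matrix.mulVec_smul, smul_sub, smul_add]

theorem mem_preN_univ_of_pow_mulVec_mem_span (k : ℕ) :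
    ∀ x : Fin n → ℝ, (A ^ k).mulVec x ∈ Submodule.span ℝ
      {v : Fin n → ℝ | ∃ j : ℕ, j < k ∧ ∃ (w : Fin m → ℝ) (z : Fin l → ℝ),
        v = (A ^ j).mulVec (B.mulVec w + E.mulVec z)} →
    x ∈ preN (dcDyn (linDyn A B E)) univ k {0} := by
  induction k with
  | zero =>
    intro x hx
    simpa [preN] using hx
  | succ k ih =>
    intro x hx
    obtain ⟨w, z, h⟩ := exists_sub_mem_span_of_mem_span_succ k hx
    refine ⟨(-w, -z), mem_univ _, ih _ ?_⟩
    convert h using 1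
    simp only [dcDyn, linDyn, Matrix.mulVec_add, Matrix.mulVec_neg, pow_succ,
      ← Matrix.mulVec_mulVec]
    abel

/-- A convex set absorbing the coordinate axes absorbs every bounded set. -/
theorem exists_pos_smul_subset_of_convex {P C : Set (Fin n → ℝ)} (hn : 0 < n)
    (hP : Convex ℝ P) (habs : ∀ x, ∀ᶠ t : ℝ in nhds 0, t • x ∈ P)
    (hC : Bornology.IsBounded C) : ∃ ε : ℝ, 0 < ε ∧ ε • C ⊆ P := by
  obtain ⟨M, hM0, hM⟩ := hC.exists_pos_norm_le
  have hall : ∀ᶠ t : ℝ in nhds 0, ∀ i : Fin n, t • (Pi.single i 1 : Fin n → ℝ) ∈ P :=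
    Filter.eventually_all.2 fun i => habs _
  obtain ⟨r, hr, hball⟩ := Metric.eventually_nhds_iff.1 hall
  have hn' : (0 : ℝ) < n := by exact_mod_cast hn
  refine ⟨r / (2 * n * M), by positivity, ?_⟩
  rintro _ ⟨x, hx, rfl⟩
  have hxi (i : Fin n) : |x i| ≤ M := (norm_le_pi_norm x i).trans (hM x hx)
  have hmem (i : Fin n) : (n * (r / (2 * n * M) * x i)) • (Pi.single i 1 : Fin n → ℝ) ∈ P := by
    refine hball ?_ i
    rw [dist_zero_right, Real.norm_eq_abs,
      show n * (r / (2 * n * M) * x i) = r / (2 * M) * x i by field_simp, abs_mul,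
      abs_of_pos (show 0 < r / (2 * M) by positivity)]
    calc r / (2 * M) * |x i| ≤ r / (2 * M) * M := by gcongr; exact hxi i
      _ = r / 2 := by field_simp
      _ < r := by linarith
  have hsum := hP.sum_mem (t := Finset.univ) (w := fun _ : Fin n => (n : ℝ)⁻¹)
    (fun _ _ => by positivity) (by simp [hn'.ne']) (fun i _ => hmem i)
  convert hsum using 1
  ext j
  simp [Finset.sum_apply, Pi.single_apply]
  field_simp

/-- A scaling of a bounded set other than `{0}` into itself has factor at most one. -/
theorem le_one_of_smul_subset_self {V : Type*} [NormedAddCommGroup V] [NormedSpace ℝ V]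
    {C : Set V} (hC : Bornology.IsBounded C) {x : V} (hx : x ∈ C) (hx0 : x ≠ 0) {a : ℝ}
    (h : a • C ⊆ C) : a ≤ 1 := by
  by_contra! ha
  obtain ⟨M, hM⟩ := hC.exists_norm_le
  have hpow (k : ℕ) : a ^ k • x ∈ C := by
    induction k with
    | zero => simpa using hx
    | succ k ih =>
      rw [pow_succ', mul_smul]
      exact h (smul_mem_smul_set ih)
  obtain ⟨k, hk⟩ := pow_unbounded_of_one_lt (M / ‖x‖) ha
  have := hM _ (hpow k)
  rw [norm_smul, norm_pow, Real.norm_of_nonneg (by linarith)] at this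
  rw [div_lt_iff₀ (norm_pos_iff.2 hx0)] at hk
  linarith

end Linear

/-- **Theorem (single-phase convergence of the projections under controllability).**
If `𝒟(Σ)` is controllable, then for any `N ≥ n`, with `γ_max` the maximal `γ` such that
`γ C_{max,co} ⊆ Pre^N_{𝒟(Σ)}({0}, S_xu × D)` and `λ₀` the maximal `λ` with
`λ C_{max,co} ⊆ π_n(C_{max,p₀})`: (i) `γ_max > 0`, and (ii) for every `k ≥ 0`,
`(1 - (1-λ₀)(1-γ_max)^k) C_{max,co} ⊆ π_n(C_{max,p₀+kN}) ⊆ C_{max,co}`. -/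
theorem proj_maxRCIS_single_phase_convergence {n m l : ℕ}
    (A : Matrix (Fin n) (Fin n) ℝ) (B : Matrix (Fin n) (Fin m) ℝ)
    (E : Matrix (Fin n) (Fin l) ℝ)
    (hctrb : Submodule.span ℝ
      {v : Fin n → ℝ | ∃ k : ℕ, k < n ∧ ∃ (w : Fin m → ℝ) (z : Fin l → ℝ),
        v = (A ^ k).mulVec (B.mulVec w + E.mulVec z)} = ⊤)
    (D : Set (Fin l → ℝ)) (S : Set ((Fin n → ℝ) × (Fin m → ℝ)))
    (hDconv : Convex ℝ D) (hDcpt : IsCompact D)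
    (hSconv : Convex ℝ S) (hScpt : IsCompact S)
    (h0int : ((0 : Fin n → ℝ), ((0 : Fin m → ℝ), (0 : Fin l → ℝ))) ∈
      interior (dcSafe S D))
    (Cfam : (q : ℕ) → Set ((Fin n → ℝ) × (Fin q → (Fin l → ℝ))))
    (hCfam : ∀ q : ℕ, IsMaxRCIS (augDyn (linDyn A B E) q) D (augSafe S D q) (Cfam q))
    (p₀ : ℕ) (h0proj : (0 : Fin n → ℝ) ∈ Prod.fst '' (Cfam p₀))
    (Cco : Set (Fin n → ℝ))
    (hCco : IsMaxCIS (dcDyn (linDyn A B E)) (dcSafe S D) Cco)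
    (N : ℕ) (hN : n ≤ N)
    (γmax : ℝ)
    (hγmax : IsGreatest {γ : ℝ |
      γ • Cco ⊆ preN (dcDyn (linDyn A B E)) (dcSafe S D) N {0}} γmax)
    (lam0 : ℝ)
    (hlam0 : IsGreatest {t : ℝ | t • Cco ⊆ Prod.fst '' (Cfam p₀)} lam0) :
    0 < γmax ∧
      ∀ k : ℕ,
        (1 - (1 - lam0) * (1 - γmax) ^ k) • Cco ⊆ Prod.fst '' (Cfam (p₀ + k * N)) ∧
        Prod.fst '' (Cfam (p₀ + k * N)) ⊆ Cco := by
  set g := dcDyn (linDyn A B E) with hg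
  have hQ : Convex ℝ (dcSafe S D) := convex_dcSafe hSconv hDconv
  have h0Q : dcSafe S D ∈ nhds 0 := mem_interior_iff_mem_nhds.1 h0int
  have h0mem := mem_of_mem_nhds h0Q
  have h0C : (0 : Fin n → ℝ) ∈ Cco := by
    refine hCco.2 {0} ?_ rfl
    rintro _ rfl
    exact ⟨0, h0mem, dcDyn_linDyn_zero A B E⟩
  have hup (q : ℕ) : Prod.fst '' Cfam q ⊆ Cco :=
    hCco.2 _ ((hCfam q).1.isCIS_image_fst ⟨0, h0mem.2⟩)
  have hbdd : Bornology.IsBounded Cco := by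
    refine (hScpt.image continuous_fst).isBounded.subset fun x hx => ?_
    obtain ⟨v, hv, -⟩ := hCco.1 x hx
    exact ⟨_, hv.1, rfl⟩
  have h0pre : (0 : Fin n → ℝ) ∈ preN g (dcSafe S D) N {0} := by
    refine IsCIS.subset_preN ?_ N rfl
    rintro _ rfl
    exact ⟨0, h0mem, dcDyn_linDyn_zero A B E⟩
  obtain ⟨x₀, hx₀, hx₀0⟩ : ∃ x ∈ Cco, x ≠ 0 := by
    by_contra! hall
    have : γmax + 1 ≤ γmax := hγmax.2 <| by
      rintro _ ⟨x, hx, rfl⟩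
      simpa [hall x hx] using h0pre
    linarith
  have hn : 0 < n := by
    rcases Nat.eq_zero_or_pos n with rfl | hn
    · exact absurd (Subsingleton.elim _ _) hx₀0
    · exact hn
  have hγ1 : γmax ≤ 1 := le_one_of_smul_subset_self hbdd hx₀ hx₀0
    (hγmax.1.trans (hCco.preN_subset (singleton_subset_iff.2 h0C) N))
  have hl1 : lam0 ≤ 1 := le_one_of_smul_subset_self hbdd hx₀ hx₀0 (hlam0.1.trans (hup p₀))
  have hl0 : 0 ≤ lam0 := hlam0.2 <| by
    rintro _ ⟨x, -, rfl⟩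
    simpa using h0proj
  have hγ0 : 0 < γmax := by
    obtain ⟨ε, hε, hsub⟩ := exists_pos_smul_subset_of_convex hn
      (convex_preN_zero (A := A) (B := B) (E := E) hQ N)
      (fun x => eventually_smul_mem_preN h0Q N x
        (mem_preN_univ_of_pow_mulVec_mem_span N x (by
          refine Submodule.span_mono ?_ (hctrb ▸ Submodule.mem_top :
            (A ^ N).mulVec x ∈ Submodule.span ℝ _)
          rintro v ⟨j, hj, h⟩
          exact ⟨j, hj.trans_le hN, h⟩))) hbdd
    exact hε.trans_le (hγmax.2 hsub)
  refine ⟨hγ0, fun k => ⟨?_, hup _⟩⟩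
  induction k with
  | zero =>
    rw [show p₀ + 0 * N = p₀ by ring]
    simpa using hlam0.1
  | succ k ih =>
    set a := (1 - lam0) * (1 - γmax) ^ k with ha
    have ha0 : 0 ≤ a := mul_nonneg (by linarith) (pow_nonneg (by linarith) k)
    have ha1 : a ≤ 1 := mul_le_one₀ (by linarith) (pow_nonneg (by linarith) k)
      (pow_le_one₀ (by linarith) (by linarith))
    rw [show p₀ + (k + 1) * N = p₀ + k * N + N by ring]
    refine subset_trans ?_ (preN_image_fst_subset hCfam (p₀ + k * N) N)
    rintro _ ⟨x, hx, rfl⟩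
    have hcombo := preN_combo (A := A) (B := B) (E := E) (T := Prod.fst '' Cfam (p₀ + k * N))
      hQ (sub_nonneg.2 ha1) ha0 (by ring) (P := Cco) (R := {0})
      (by
        rintro y hy _ rfl
        simpa using ih (smul_mem_smul_set hy)) N
      x (hCco.1.subset_preN N hx) (γmax • x) (hγmax.1 (smul_mem_smul_set hx))
    convert hcombo using 1
    rw [ha]
    module
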